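/- Let p be a prime, q = p^r with r ≥ 1, m ≥ 2, and let f ∈ 𝔽_{q^m}(z) be a nonconstant rational function with p-linear degree e(f) = 0. Then for every nonzero y ∈ 𝔽_q there exist no h ∈ 𝔽_{q^m}(z) and c ∈ 𝔽_{q^m} with y·f = h^p − h + c; consequently D(f) = {0}, i.e., #D(f) = 1. -/

import Mathlib

open Polynomial

/-- The natural embedding `RatFunc K →+* RatFunc L` induced by a field embedding `K →+* L`. -/
noncomputable def ratFuncMap {K L : Type} [Field K] [Field L] (φ : K →+* L) :
    RatFunc K →+* RatFunc L :=
  RatFunc.mapRingHom (Polynomial.mapRingHom φ) (by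
    intro q hq
    simp only [Submonoid.mem_comap, coe_mapRingHom]
    rw [mem_nonZeroDivisors_iff_ne_zero] at hq ⊢
    exact (Polynomial.map_ne_zero_iff φ.injective).mpr hq)

/-- `f` can be written as `a₀ + ∑_{i=0}^{e} aᵢ h^{pⁱ}` with top coefficient nonzero. -/
def HasPRep (p : ℕ) {K : Type} [Field K] (f : RatFunc K) (e : ℕ) : Prop :=
  ∃ (h : RatFunc K) (a₀ : K) (a : ℕ → K), a e ≠ 0 ∧
    f = RatFunc.C a₀ + ∑ i ∈ Finset.range (e + 1), RatFunc.C (a i) * h ^ p ^ i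

/-- `e` is the `p`-linear degree `e(f)` of `f`. -/
def IsPLinearDegree (p : ℕ) {K : Type} [Field K] (f : RatFunc K) (e : ℕ) : Prop :=
  HasPRep p f e ∧ ∀ e' : ℕ, HasPRep p f e' → e' ≤ e

theorem ratFuncMap_algebraMap' {K L : Type} [Field K] [Field L] (φ : K →+* L) (P : K[X]) :
    ratFuncMap φ (algebraMap K[X] (RatFunc K) P) = algebraMap L[X] (RatFunc L) (P.map φ) := by
  have := RatFunc.map_apply_div (K := K) (Polynomial.mapRingHom φ) (by
    intro q hq
    simp only [Submonoid.mem_comap, coe_mapRingHom]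
    rw [mem_nonZeroDivisors_iff_ne_zero] at hq ⊢
    exact (Polynomial.map_ne_zero_iff φ.injective).mpr hq) P 1
  simp only [map_one, div_one, coe_mapRingHom] at this
  exact this

theorem ratFuncMap_C' {K L : Type} [Field K] [Field L] (φ : K →+* L) (a : K) :
    ratFuncMap φ (RatFunc.C a) = RatFunc.C (φ a) := by
  rw [← RatFunc.algebraMap_C, ratFuncMap_algebraMap', Polynomial.map_C, RatFunc.algebraMap_C]

theorem ratFuncMap_comp_eq {K L : Type} [Field K] [Field L] (ι : K →+* L) (φ : L →+* L)
    (h : ∀ a, φ (ι a) = ι a) (f : RatFunc K) :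
    ratFuncMap φ (ratFuncMap ι f) = ratFuncMap ι f := by
  have hc : φ.comp ι = ι := RingHom.ext h
  rw [← RatFunc.num_div_denom f]
  simp only [map_div₀, ratFuncMap_algebraMap', Polynomial.map_map, hc]

theorem poly_descend {K L : Type} [Field K] [Field L] (ι : K →+* L) (φ : L →+* L)
    (h : ∀ x, φ x = x → ∃ a, ι a = x) (P : L[X]) (hP : P.map φ = P) :
    ∃ P' : K[X], P'.map ι = P := by
  have : P ∈ Polynomial.lifts ι := by
    rw [Polynomial.lifts_iff_coeff_lifts]
    intro n
    apply h
    conv_rhs => rw [← hP]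
    rw [Polynomial.coeff_map]
  rwa [Polynomial.mem_lifts] at this

theorem ratFunc_descend {K L : Type} [Field K] [Field L] (ι : K →+* L) (φ : L →+* L)
    (h : ∀ x, φ x = x → ∃ a, ι a = x) (w : RatFunc L) (hw : ratFuncMap φ w = w) :
    ∃ w' : RatFunc K, ratFuncMap ι w' = w := by
  have hD0 := RatFunc.denom_ne_zero w
  have hmon := RatFunc.monic_denom w
  have hD0' : w.denom.map φ ≠ 0 := (Polynomial.map_ne_zero_iff φ.injective).mpr hD0
  have e1 : w.num.map φ * w.denom = w.num * w.denom.map φ := by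
    have h1 := hw
    rw [← RatFunc.num_div_denom w, map_div₀, ratFuncMap_algebraMap', ratFuncMap_algebraMap',
      div_eq_div_iff (by simpa using hD0') (by simpa using hD0), ← map_mul, ← map_mul] at h1
    exact RatFunc.algebraMap_injective L h1
  have hdvd : w.denom ∣ w.denom.map φ := by
    apply (RatFunc.isCoprime_num_denom w).symm.dvd_of_dvd_mul_left
    rw [← e1]
    exact dvd_mul_left _ _
  have hD : w.denom.map φ = w.denom :=
    Polynomial.eq_of_monic_of_dvd_of_natDegree_le hmon (hmon.map φ) hdvd
      (by rw [Polynomial.natDegree_map])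
  have hN : w.num.map φ = w.num := by
    rw [hD] at e1
    exact mul_right_cancel₀ hD0 e1
  obtain ⟨N, hN'⟩ := poly_descend ι φ h _ hN
  obtain ⟨D, hD'⟩ := poly_descend ι φ h _ hD
  refine ⟨algebraMap _ _ N / algebraMap _ _ D, ?_⟩
  rw [map_div₀, ratFuncMap_algebraMap', ratFuncMap_algebraMap', hN', hD', RatFunc.num_div_denom]

theorem mem_range_of_pow_card {K L : Type} [Field K] [Field L] [Fintype K] (ι : K →+* L)
    (x : L) (hx : x ^ Fintype.card K = x) : ∃ a, ι a = x := by
  have hne : (X ^ Fintype.card K - X : K[X]) ≠ 0 :=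
    FiniteField.X_pow_card_sub_X_ne_zero K Fintype.one_lt_card
  have hs : (X ^ Fintype.card K - X : K[X]).Splits := by
    rw [Polynomial.splits_iff_card_roots, FiniteField.roots_X_pow_card_sub_X,
      FiniteField.X_pow_card_sub_X_natDegree_eq K Fintype.one_lt_card]
    rfl
  have hr := hs.roots_map ι
  have hx' : x ∈ ((X ^ Fintype.card K - X : K[X]).map ι).roots := by
    rw [Polynomial.mem_roots ((Polynomial.map_ne_zero_iff ι.injective).mpr hne)]
    simp [hx]
  rw [hr, Multiset.mem_map] at hx'
  obtain ⟨a, -, ha⟩ := hx'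
  exact ⟨a, ha⟩

theorem artinSchreier_descend (p n : ℕ) (hp : p.Prime) (hn : n ≠ 0) (K : Type) [Field K] [Fintype K]
    (hK : Fintype.card K = p ^ n) (g : RatFunc K) (w : RatFunc (AlgebraicClosure K))
    (hw : ratFuncMap (algebraMap K (AlgebraicClosure K)) g = w ^ p - w) :
    ∃ (h : RatFunc K) (c : K), g = h ^ p - h + RatFunc.C c := by
  have : Fact p.Prime := ⟨hp⟩
  have : CharP K p := by
    obtain ⟨k, hk, hc⟩ := FiniteField.card K (ringChar K)
    have : ringChar K = p := by
      rw [hK] at hc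
      have h1 : p ∣ ringChar K ^ (k : ℕ) := hc ▸ dvd_pow_self p hn
      exact ((Nat.prime_dvd_prime_iff_eq hp hk).mp (hp.dvd_of_dvd_pow h1)).symm
    exact this ▸ ringChar.charP K
  let L := AlgebraicClosure K
  let ι : K →+* L := algebraMap K L
  have : CharP L p := charP_of_injective_ringHom ι.injective p
  have : CharP (RatFunc L) p :=
    charP_of_injective_ringHom (RatFunc.C (K := L)).injective p
  let φ : L →+* L := iterateFrobenius L p n
  have hφ : ∀ x, φ x = x ^ p ^ n := fun x => iterateFrobenius_def p n x
  have hφι : ∀ a, φ (ι a) = ι a := fun a => by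
    rw [hφ, ← map_pow, ← hK, FiniteField.pow_card]
  have hfix : ∀ x, φ x = x → ∃ a, ι a = x := fun x hx =>
    mem_range_of_pow_card ι x (by rw [hK, ← hφ, hx])
  have hw1 : ratFuncMap φ w ^ p - ratFuncMap φ w = w ^ p - w := by
    rw [← map_pow, ← map_sub, ← hw]
    exact ratFuncMap_comp_eq ι φ hφι g
  have hu : (ratFuncMap φ w - w) ^ p = ratFuncMap φ w - w := by
    rw [sub_pow_char]
    linear_combination hw1
  have hu' : ratFuncMap φ w - w ∈ (RatFunc.C (K := L)).fieldRange :=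
    bot_le (a := (RatFunc.C (K := L)).fieldRange)
      ((Subfield.mem_bot_iff_pow_eq_self (RatFunc L) p).mpr hu)
  obtain ⟨u, hu2⟩ := hu'
  have hup : u ^ p = u := by
    apply (RatFunc.C (K := L)).injective
    rw [map_pow, hu2, hu]
  obtain ⟨α, hα⟩ : ∃ α : L, α ^ p ^ n - α = u := by
    have hdeg : (X ^ p ^ n - X - C u : L[X]).natDegree = p ^ n := by
      rw [Polynomial.natDegree_sub_C]
      exact FiniteField.X_pow_card_pow_sub_X_natDegree_eq L hn hp.one_lt
    obtain ⟨α, hα⟩ := IsAlgClosed.exists_root (X ^ p ^ n - X - C u : L[X]) (by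
      intro h0
      have := Polynomial.natDegree_eq_of_degree_eq_some h0
      rw [hdeg] at this
      exact pow_ne_zero n hp.ne_zero this)
    refine ⟨α, ?_⟩
    simp only [Polynomial.IsRoot, eval_sub, eval_pow, eval_X, eval_C] at hα
    exact sub_eq_zero.mp hα
  obtain ⟨h, hh⟩ := ratFunc_descend ι φ hfix (w - RatFunc.C α) (by
    rw [map_sub, ratFuncMap_C', hφ]
    have : α ^ p ^ n = α + u := by linear_combination hα
    rw [this, map_add, hu2]
    ring)
  obtain ⟨c, hc⟩ := hfix (α ^ p - α) (by
    have e : φ α = α + u := by rw [hφ]; linear_combination hα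
    rw [map_sub, map_pow, e, add_pow_char, hup]
    ring)
  refine ⟨h, c, (ratFuncMap ι).injective ?_⟩
  have hw' : ratFuncMap ι g = w ^ p - w := hw
  rw [hw', map_add, map_sub, map_pow, hh, ratFuncMap_C', hc, sub_pow_char, map_sub, map_pow]
  ring

/-- If `f` is nonconstant with `e(f) = 0`, then no nonzero `𝔽_q`-multiple
of `f` is of the form `h^p − h + c` with `h ∈ 𝔽_{q^m}(z)`, `c ∈ 𝔽_{q^m}`; consequently
`D(f) = {0}`. -/
theorem stmt_16 (p r m : ℕ) (hp : p.Prime) (hr : 1 ≤ r) (hm : 2 ≤ m)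
    (F K : Type) [Field F] [Field K] [Algebra F K] [Fintype F] [Fintype K]
    (hF : Fintype.card F = p ^ r) (hK : Fintype.card K = (p ^ r) ^ m)
    (f : RatFunc K) (hf : ∀ c : K, f ≠ RatFunc.C c)
    (he : IsPLinearDegree p f 0) :
    (∀ y : F, y ≠ 0 →
        ¬ ∃ (h : RatFunc K) (c : K),
          RatFunc.C (algebraMap F K y) * f = h ^ p - h + RatFunc.C c) ∧
      {y : F | ∃ h : RatFunc (AlgebraicClosure K),
        ratFuncMap (algebraMap K (AlgebraicClosure K))
          (RatFunc.C (algebraMap F K y) * f) = h ^ p - h} = {0} := by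
  have h1 : ∀ y : F, y ≠ 0 →
      ¬ ∃ (h : RatFunc K) (c : K),
        RatFunc.C (algebraMap F K y) * f = h ^ p - h + RatFunc.C c := by
    rintro y hy ⟨h, c, hc⟩
    have hb : algebraMap F K y ≠ 0 := (_root_.map_ne_zero _).mpr hy
    have hb' : (RatFunc.C (algebraMap F K y) : RatFunc K) ≠ 0 := (_root_.map_ne_zero _).mpr hb
    have := he.2 1 ⟨h, (algebraMap F K y)⁻¹ * c,
      fun i => if i = 0 then -(algebraMap F K y)⁻¹ else (algebraMap F K y)⁻¹,
      by simpa using hy, by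
        apply mul_left_cancel₀ hb'
        rw [hc]
        simp only [Finset.sum_range_succ, Finset.sum_range_zero, map_mul, map_neg, map_inv₀,
          if_true, one_ne_zero, if_false, pow_zero, pow_one]
        field_simp
        ring⟩
    omega
  refine ⟨h1, ?_⟩
  ext y
  simp only [Set.mem_ofPred_eq, Set.mem_singleton_iff]
  constructor
  · rintro ⟨w, hw⟩
    by_contra hy
    refine h1 y hy ?_
    exact artinSchreier_descend p (r * m) hp (by positivity) K (by rw [hK, pow_mul]) _ w hw
  · rintro rfl
    exact ⟨0, by simp [hp.ne_zero]⟩
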